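/- Let n ≥ 2 and α > 0. Then ∫₀¹ x^{α−1} (1−x)^{(n−3)/2} G(x) dx < ∞, the function y ↦ ∫_y^1 x^{−1} (1−x)^{(n−3)/2} G(x) dx is finite on (0,1) with ∫₀¹ y^{α−1} ( ∫_y^1 x^{−1} (1−x)^{(n−3)/2} G(x) dx ) dy < ∞, and α · ∫₀¹ y^{α−1} ( ∫_y^1 x^{−1} (1−x)^{(n−3)/2} G(x) dx ) dy = ∫₀¹ x^{α−1} (1−x)^{(n−3)/2} G(x) dx. -/

import Mathlib

open MeasureTheory Set

/-- The recursively defined coefficients `γ_i(m)` from the paper (depending on `n`). -/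
noncomputable def gammaCoeff (n : ℕ) : ℕ → ℕ → ℝ
  | 0, _ => 0
  | 1, m => if m = 0 then 1 else 0
  | (i + 2), m =>
      (Real.Gamma ((m : ℝ) + ((i : ℝ) + 1) * ((i : ℝ) + 2) / (2 * (n : ℝ))) /
        Real.Gamma ((m : ℝ) + ((i : ℝ) + 2) * ((i : ℝ) + 3) / (2 * (n : ℝ)))) *
      ∑ k ∈ Finset.range (m + 1),
        (Real.Gamma (((m - k : ℕ) : ℝ) + ((i : ℝ) + 2) / (n : ℝ)) /
          (Nat.factorial (m - k) : ℝ)) * gammaCoeff n (i + 1) k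

/-- `d_m = γ_{n−1}(m)`. -/
noncomputable def dCoeff (n : ℕ) (m : ℕ) : ℝ := gammaCoeff n (n - 1) m

/-- `G(y) = Σ_{m≥0} d_m (1−y)^m`. -/
noncomputable def Gfun (n : ℕ) (y : ℝ) : ℝ := ∑' m : ℕ, dCoeff n m * (1 - y) ^ m

open ProbabilityTheory in
theorem lintegral_rpow_mul_one_sub_rpow {a b : ℝ} (ha : 0 < a) (hb : 0 < b) :
    ∫⁻ x in Ioo (0 : ℝ) 1, ENNReal.ofReal (x ^ (a - 1) * (1 - x) ^ (b - 1)) =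
      ENNReal.ofReal (beta a b) := by
  have hB := beta_pos ha hb
  have h : ∫⁻ x in Ioo (0 : ℝ) 1, ENNReal.ofReal (1 / beta a b * x ^ (a - 1) * (1 - x) ^ (b - 1))
      = 1 := by
    rw [← lintegral_betaPDF, lintegral_betaPDF_eq_one ha hb]
  calc _ = ∫⁻ x in Ioo (0 : ℝ) 1, ENNReal.ofReal (beta a b) *
        ENNReal.ofReal (1 / beta a b * x ^ (a - 1) * (1 - x) ^ (b - 1)) := by
        refine lintegral_congr fun x => ?_
        rw [← ENNReal.ofReal_mul hB.le]
        congr 1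
        field_simp
    _ = _ := by rw [lintegral_const_mul' _ _ ENNReal.ofReal_ne_top, h, mul_one]

theorem lintegral_rpow_mul_exp_neg_mul_Ioi {a r : ℝ} (ha : 0 < a) (hr : 0 < r) :
    ∫⁻ u in Ioi (0 : ℝ), ENNReal.ofReal (u ^ (a - 1) * Real.exp (-(r * u))) =
      ENNReal.ofReal ((1 / r) ^ a * Real.Gamma a) := by
  have h := Real.integral_rpow_mul_exp_neg_mul_Ioi ha hr
  have hpos : 0 < (1 / r) ^ a * Real.Gamma a := by
    have := Real.Gamma_pos_of_pos ha
    positivity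
  have hint : Integrable (fun u : ℝ => u ^ (a - 1) * Real.exp (-(r * u)))
      (volume.restrict (Ioi 0)) :=
    Integrable.of_integral_ne_zero (by rw [h]; exact hpos.ne')
  rw [← h, ofReal_integral_eq_lintegral_ofReal hint]
  filter_upwards [ae_restrict_mem measurableSet_Ioi] with u hu
  have : (0 : ℝ) < u := hu
  positivity

theorem tsum_ofReal_Gamma_div_factorial_mul_pow {b t : ℝ} (hb : 0 < b) (ht : 0 ≤ t)
    (ht1 : t < 1) :
    ∑' j : ℕ, ENNReal.ofReal (Real.Gamma (j + b) / (Nat.factorial j : ℝ) * t ^ j) =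
      ENNReal.ofReal (Real.Gamma b * (1 - t) ^ (-b)) := by
  have hterm (j : ℕ) : ENNReal.ofReal (Real.Gamma (j + b) / (Nat.factorial j : ℝ) * t ^ j) =
      ∫⁻ u in Ioi (0 : ℝ), ENNReal.ofReal
        (u ^ (b - 1) * Real.exp (-u) * ((t * u) ^ j / (Nat.factorial j : ℝ))) := by
    have h := lintegral_rpow_mul_exp_neg_mul_Ioi (a := j + b) (r := 1) (by positivity) one_pos
    simp only [one_mul, div_one, Real.one_rpow] at h
    have hc : 0 ≤ t ^ j / (Nat.factorial j : ℝ) := by positivity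
    rw [show Real.Gamma (j + b) / (Nat.factorial j : ℝ) * t ^ j =
      t ^ j / (Nat.factorial j : ℝ) * Real.Gamma (j + b) by ring, ENNReal.ofReal_mul hc, ← h,
      ← lintegral_const_mul' _ _ ENNReal.ofReal_ne_top]
    refine setLIntegral_congr_fun measurableSet_Ioi fun u hu => ?_
    have hu : 0 < u := hu
    rw [← ENNReal.ofReal_mul hc, show (j : ℝ) + b - 1 = b - 1 + j by ring,
      Real.rpow_add_natCast hu.ne', mul_pow]
    congr 1
    ring
  simp_rw [hterm]
  rw [← lintegral_tsum (fun j => by fun_prop)]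
  have h := lintegral_rpow_mul_exp_neg_mul_Ioi (r := 1 - t) hb (by linarith)
  rw [one_div, Real.inv_rpow (by linarith), ← Real.rpow_neg (by linarith), mul_comm] at h
  rw [← h]
  refine setLIntegral_congr_fun measurableSet_Ioi fun u hu => ?_
  have hu : 0 < u := hu
  have hs : HasSum (fun j : ℕ => (t * u) ^ j / (Nat.factorial j : ℝ)) (Real.exp (t * u)) := by
    rw [Real.exp_eq_exp_ℝ]
    exact NormedSpace.expSeries_div_hasSum_exp (t * u)
  have hs' := hs.mul_left (u ^ (b - 1) * Real.exp (-u))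
  rw [← ENNReal.ofReal_tsum_of_nonneg (fun j => by positivity) hs'.summable, hs'.tsum_eq,
    mul_assoc, ← Real.exp_add]
  ring_nf

open ProbabilityTheory in
theorem tsum_ofReal_Gamma_div_factorial_mul_beta {a b s : ℝ} (ha : 0 < a) (hb : 0 < b)
    (hs : 0 < s) :
    ∑' j : ℕ, ENNReal.ofReal (Real.Gamma (j + b) / (Nat.factorial j : ℝ) * beta (a + b) (j + s)) =
      ENNReal.ofReal (Real.Gamma b * beta a s) := by
  have hterm (j : ℕ) :
      ENNReal.ofReal (Real.Gamma (j + b) / (Nat.factorial j : ℝ) * beta (a + b) (j + s)) =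
      ∫⁻ x in Ioo (0 : ℝ) 1, ENNReal.ofReal (x ^ (a + b - 1) * (1 - x) ^ (s - 1)) *
        ENNReal.ofReal (Real.Gamma (j + b) / (Nat.factorial j : ℝ) * (1 - x) ^ j) := by
    have hG := Real.Gamma_pos_of_pos (show 0 < (j : ℝ) + b by positivity)
    have hc : 0 ≤ Real.Gamma (j + b) / (Nat.factorial j : ℝ) := by positivity
    rw [ENNReal.ofReal_mul hc, ← lintegral_rpow_mul_one_sub_rpow (by positivity) (by positivity),
      ← lintegral_const_mul' _ _ ENNReal.ofReal_ne_top]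
    refine setLIntegral_congr_fun measurableSet_Ioo fun x hx => ?_
    have hx0 : 0 < x := hx.1
    have hx1 : 0 < 1 - x := sub_pos.2 hx.2
    rw [← ENNReal.ofReal_mul hc, ← ENNReal.ofReal_mul (by positivity),
      show (j : ℝ) + s - 1 = s - 1 + j by ring, Real.rpow_add_natCast hx1.ne']
    congr 1
    ring
  simp_rw [hterm]
  rw [← lintegral_tsum (fun j => by fun_prop)]
  have hGb := Real.Gamma_pos_of_pos hb
  rw [ENNReal.ofReal_mul hGb.le, ← lintegral_rpow_mul_one_sub_rpow ha hs,
    ← lintegral_const_mul' _ _ ENNReal.ofReal_ne_top]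
  refine setLIntegral_congr_fun measurableSet_Ioo fun x hx => ?_
  have hx0 : 0 < x := hx.1
  have hx1 : 0 < 1 - x := sub_pos.2 hx.2
  rw [ENNReal.tsum_mul_left, tsum_ofReal_Gamma_div_factorial_mul_pow hb hx1.le (by linarith),
    ← ENNReal.ofReal_mul (by positivity), ← ENNReal.ofReal_mul (by positivity), sub_sub_cancel,
    show a + b - 1 = (a - 1) + b by ring, Real.rpow_add hx0, Real.rpow_neg hx0.le]
  congr 1
  field_simp

theorem ENNReal.tsum_sum_range_mul (u c h : ℕ → ENNReal) :
    ∑' m : ℕ, h m * ∑ k ∈ Finset.range (m + 1), u (m - k) * c k =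
      ∑' k : ℕ, c k * ∑' j : ℕ, u j * h (j + k) := by
  calc _ = ∑' m : ℕ, ∑' p : Finset.HasAntidiagonal.antidiagonal m,
        u p.1.2 * c p.1.1 * h (p.1.2 + p.1.1) := by
        refine tsum_congr fun m => ?_
        rw [Finset.tsum_subtype (Finset.HasAntidiagonal.antidiagonal m)
          (fun p : ℕ × ℕ => u p.2 * c p.1 * h (p.2 + p.1)),
          Finset.Nat.sum_antidiagonal_eq_sum_range_succ_mk, Finset.mul_sum]
        refine Finset.sum_congr rfl fun k hk => ?_
        have : k ≤ m := Nat.lt_succ_iff.1 (Finset.mem_range.1 hk)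
        rw [Nat.sub_add_cancel this, mul_comm]
    _ = ∑' p : ℕ × ℕ, u p.2 * c p.1 * h (p.2 + p.1) := by
        rw [← Finset.HasAntidiagonal.sigmaAntidiagonalEquivProd.tsum_eq (_ : ℕ × ℕ → ENNReal),
          ENNReal.tsum_sigma']
        rfl
    _ = _ := by
        rw [ENNReal.tsum_prod']
        refine tsum_congr fun k => ?_
        rw [← ENNReal.tsum_mul_left]
        exact tsum_congr fun j => by ring

theorem gammaCoeff_nonneg (n i m : ℕ) : 0 ≤ gammaCoeff n i m := by
  induction i using Nat.strong_induction_on generalizing m with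
  | _ i ih =>
    match i with
    | 0 => simp [gammaCoeff]
    | 1 =>
      simp only [gammaCoeff]
      split_ifs <;> norm_num
    | i + 2 =>
      simp only [gammaCoeff]
      refine mul_nonneg (div_nonneg (Real.Gamma_nonneg_of_nonneg (by positivity))
        (Real.Gamma_nonneg_of_nonneg (by positivity))) (Finset.sum_nonneg fun k _ => ?_)
      exact mul_nonneg (div_nonneg (Real.Gamma_nonneg_of_nonneg (by positivity)) (by positivity))
        (ih (i + 1) (by omega) k)

open ProbabilityTheory in
theorem tsum_gammaCoeff_mul_beta_lt_top {n : ℕ} (hn : 0 < n) (i : ℕ) {a : ℝ} (ha : 0 < a) :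
    ∑' m : ℕ, ENNReal.ofReal (gammaCoeff n (i + 1) m) *
      ENNReal.ofReal (beta a (m + ((i : ℝ) + 1) * ((i : ℝ) + 2) / (2 * (n : ℝ)))) < ⊤ := by
  have hn' : (0 : ℝ) < n := by exact_mod_cast hn
  induction i with
  | zero =>
    rw [tsum_eq_single 0 (fun m hm => by simp [gammaCoeff, hm])]
    exact ENNReal.mul_lt_top ENNReal.ofReal_lt_top ENNReal.ofReal_lt_top
  | succ i ih =>
    set s : ℝ := ((i : ℝ) + 1) * ((i : ℝ) + 2) / (2 * (n : ℝ)) with hs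
    set b : ℝ := ((i : ℝ) + 2) / (n : ℝ) with hb
    have hs0 : 0 < s := by positivity
    have hb0 : 0 < b := by positivity
    have hsb : ((i : ℝ) + 2) * ((i : ℝ) + 3) / (2 * (n : ℝ)) = s + b := by
      rw [hs, hb]; field_simp; ring
    have hsb' : (((i + 1 : ℕ) : ℝ) + 1) * (((i + 1 : ℕ) : ℝ) + 2) / (2 * (n : ℝ)) = s + b := by
      rw [← hsb]; push_cast; ring
    have hGa := Real.Gamma_pos_of_pos ha
    have hGb := Real.Gamma_pos_of_pos hb0
    have hGab := Real.Gamma_pos_of_pos (add_pos ha hb0)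
    have hu (j : ℕ) : 0 ≤ Real.Gamma (j + b) / (Nat.factorial j : ℝ) :=
      div_nonneg (Real.Gamma_nonneg_of_nonneg (by positivity)) (by positivity)
    have hB {x y : ℝ} (hx : 0 < x) (hy : 0 < y) := (beta_pos hx hy).le
    have hterm (m : ℕ) : ENNReal.ofReal (gammaCoeff n (i + 1 + 1) m) *
        ENNReal.ofReal (beta a (m + (s + b))) =
        ENNReal.ofReal (Real.Gamma a / Real.Gamma (a + b)) *
        (ENNReal.ofReal (beta (a + b) (m + s)) * ∑ k ∈ Finset.range (m + 1),
          ENNReal.ofReal (Real.Gamma ((m - k : ℕ) + b) / (Nat.factorial (m - k) : ℝ)) *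
          ENNReal.ofReal (gammaCoeff n (i + 1) k)) := by
      have hsum : ∑ k ∈ Finset.range (m + 1),
          ENNReal.ofReal (Real.Gamma ((m - k : ℕ) + b) / (Nat.factorial (m - k) : ℝ)) *
          ENNReal.ofReal (gammaCoeff n (i + 1) k) = ENNReal.ofReal (∑ k ∈ Finset.range (m + 1),
          Real.Gamma ((m - k : ℕ) + b) / (Nat.factorial (m - k) : ℝ) *
          gammaCoeff n (i + 1) k) := by
        rw [ENNReal.ofReal_sum_of_nonneg
          (fun k _ => mul_nonneg (hu _) (gammaCoeff_nonneg n (i + 1) k))]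
        exact Finset.sum_congr rfl fun k _ => (ENNReal.ofReal_mul (hu _)).symm
      have h1 := Real.Gamma_pos_of_pos (show 0 < m + (s + b) by positivity)
      rw [hsum, ← ENNReal.ofReal_mul (gammaCoeff_nonneg _ _ _),
        ← ENNReal.ofReal_mul (hB (by positivity) (by positivity)),
        ← ENNReal.ofReal_mul (by positivity)]
      congr 1
      simp only [gammaCoeff]
      rw [hsb, ← hs, ← hb]
      simp only [beta]
      rw [show a + (m + (s + b)) = a + b + (m + s) by ring]
      field_simp
    rw [hsb']
    simp_rw [hterm]
    rw [ENNReal.tsum_mul_left, ENNReal.tsum_sum_range_mul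
      (fun j => ENNReal.ofReal (Real.Gamma (j + b) / (Nat.factorial j : ℝ)))
      (fun k => ENNReal.ofReal (gammaCoeff n (i + 1) k))
      (fun m => ENNReal.ofReal (beta (a + b) (m + s)))]
    refine ENNReal.mul_lt_top ENNReal.ofReal_lt_top ?_
    have hinner (k : ℕ) : ∑' j : ℕ, ENNReal.ofReal (Real.Gamma (j + b) / (Nat.factorial j : ℝ)) *
        ENNReal.ofReal (beta (a + b) ((j + k : ℕ) + s)) =
        ENNReal.ofReal (Real.Gamma b) * ENNReal.ofReal (beta a (k + s)) := by
      rw [← ENNReal.ofReal_mul hGb.le,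
        ← tsum_ofReal_Gamma_div_factorial_mul_beta ha hb0 (by positivity)]
      refine tsum_congr fun j => ?_
      rw [← ENNReal.ofReal_mul (hu j)]
      push_cast
      rw [add_assoc]
    simp_rw [hinner, mul_left_comm _ (ENNReal.ofReal (Real.Gamma b))]
    rw [ENNReal.tsum_mul_left]
    exact ENNReal.mul_lt_top ENNReal.ofReal_lt_top ih

theorem Gfun_nonneg (n : ℕ) {y : ℝ} (hy : y ≤ 1) : 0 ≤ Gfun n y :=
  tsum_nonneg fun m => mul_nonneg (gammaCoeff_nonneg _ _ _) (pow_nonneg (by linarith) m)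

theorem Gfun_eq_toReal (n : ℕ) {y : ℝ} (hy : y ≤ 1) :
    Gfun n y = (∑' m : ℕ, ENNReal.ofReal (dCoeff n m * (1 - y) ^ m)).toReal := by
  rw [ENNReal.tsum_toReal_eq fun _ => ENNReal.ofReal_ne_top]
  exact tsum_congr fun m => (ENNReal.toReal_ofReal
    (mul_nonneg (gammaCoeff_nonneg _ _ _) (pow_nonneg (by linarith) m))).symm

theorem aestronglyMeasurable_Gfun (n : ℕ) :
    AEStronglyMeasurable (Gfun n) (volume.restrict (Ioo 0 1)) := by
  have hm : Measurable fun y : ℝ =>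
      (∑' m : ℕ, ENNReal.ofReal (dCoeff n m * (1 - y) ^ m)).toReal :=
    (Measurable.tsum fun m => by fun_prop).ennreal_toReal
  refine hm.aestronglyMeasurable.congr ?_
  filter_upwards [ae_restrict_mem measurableSet_Ioo] with y hy
  exact (Gfun_eq_toReal n hy.2.le).symm

theorem integrableOn_rpow_mul_Gfun {n : ℕ} (hn : 2 ≤ n) {a : ℝ} (ha : 0 < a) :
    IntegrableOn (fun x : ℝ => x ^ (a - 1) * (1 - x) ^ (((n : ℝ) - 3) / 2) * Gfun n x)
      (Ioo 0 1) := by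
  obtain ⟨i, rfl⟩ : ∃ i, n = i + 2 := ⟨n - 2, by omega⟩
  have hmeas : AEStronglyMeasurable (fun x : ℝ => x ^ (a - 1) *
      (1 - x) ^ ((((i + 2 : ℕ) : ℝ) - 3) / 2)) (volume.restrict (Ioo 0 1)) :=
    Measurable.aestronglyMeasurable (by fun_prop)
  refine ⟨hmeas.mul (aestronglyMeasurable_Gfun _), ?_⟩
  have hfin := tsum_gammaCoeff_mul_beta_lt_top (n := i + 2) (by omega) i ha
  refine lt_of_le_of_lt ?_ hfin
  have hterm (m : ℕ) : ENNReal.ofReal (gammaCoeff (i + 2) (i + 1) m) *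
      ENNReal.ofReal (ProbabilityTheory.beta a
        (m + ((i : ℝ) + 1) * ((i : ℝ) + 2) / (2 * ((i + 2 : ℕ) : ℝ)))) =
      ∫⁻ x in Ioo (0 : ℝ) 1,
        ENNReal.ofReal (x ^ (a - 1) * (1 - x) ^ ((((i + 2 : ℕ) : ℝ) - 3) / 2)) *
        ENNReal.ofReal (dCoeff (i + 2) m * (1 - x) ^ m) := by
    rw [← lintegral_rpow_mul_one_sub_rpow ha (by positivity),
      ← lintegral_const_mul' _ _ ENNReal.ofReal_ne_top]
    refine setLIntegral_congr_fun measurableSet_Ioo fun x hx => ?_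
    have hx0 : 0 < x := hx.1
    have hx1 : 0 < 1 - x := sub_pos.2 hx.2
    rw [← ENNReal.ofReal_mul (gammaCoeff_nonneg _ _ _), ← ENNReal.ofReal_mul (by positivity),
      show (m : ℝ) + ((i : ℝ) + 1) * ((i : ℝ) + 2) / (2 * ((i + 2 : ℕ) : ℝ)) - 1
        = (((i + 2 : ℕ) : ℝ) - 3) / 2 + m by push_cast; field_simp; ring,
      Real.rpow_add_natCast hx1.ne', dCoeff, show i + 2 - 1 = i + 1 by omega]
    congr 1
    ring
  simp_rw [hterm]
  rw [← lintegral_tsum (fun m => by fun_prop)]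
  refine setLIntegral_mono' measurableSet_Ioo fun x hx => ?_
  have hx0 : 0 < x := hx.1
  have hx1 : 0 < 1 - x := sub_pos.2 hx.2
  rw [ENNReal.tsum_mul_left, ← ofReal_norm, Real.norm_of_nonneg
    (mul_nonneg (by positivity) (Gfun_nonneg _ hx.2.le)), ENNReal.ofReal_mul (by positivity)]
  gcongr
  rw [Gfun_eq_toReal _ hx.2.le]
  exact ENNReal.ofReal_toReal_le

theorem integral_Ioo_rpow_sub_one {a x : ℝ} (ha : 0 < a) (hx : 0 < x) :
    IntegrableOn (fun y : ℝ => y ^ (a - 1)) (Ioo 0 x) ∧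
      ∫ y in Ioo (0 : ℝ) x, y ^ (a - 1) = x ^ a / a := by
  constructor
  · have := (intervalIntegral.intervalIntegrable_rpow' (a := 0) (b := x) (r := a - 1)
      (by linarith)).1
    exact this.mono_set Ioo_subset_Ioc_self
  · rw [← integral_Ioc_eq_integral_Ioo, ← intervalIntegral.integral_of_le hx.le,
      integral_rpow (Or.inl (by linarith)), sub_add_cancel, Real.zero_rpow ha.ne', sub_zero]

/-- Tonelli's theorem for the tail integral `∫_y^1 w` against the weight `y ^ (a - 1)`. -/
theorem integral_rpow_mul_integral_Ioo {a : ℝ} (ha : 0 < a) {w : ℝ → ℝ}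
    (hw : IntegrableOn (fun x => x ^ a * w x) (Ioo 0 1)) :
    IntegrableOn (fun y : ℝ => y ^ (a - 1) * ∫ x in Ioo y 1, w x) (Ioo 0 1) ∧
      a * ∫ y in Ioo (0 : ℝ) 1, y ^ (a - 1) * ∫ x in Ioo y 1, w x =
        ∫ x in Ioo (0 : ℝ) 1, x ^ a * w x := by
  set μ : Measure ℝ := volume.restrict (Ioo 0 1) with hμ
  let f : ℝ → ℝ → ℝ := fun y x => (Iio x).indicator (fun y => y ^ (a - 1)) y * w x
  have hwm : AEStronglyMeasurable w μ := by
    have h1 : AEStronglyMeasurable (fun x : ℝ => x ^ (-a)) μ :=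
      Measurable.aestronglyMeasurable (by fun_prop)
    refine (h1.mul hw.1).congr ?_
    filter_upwards [ae_restrict_mem measurableSet_Ioo] with x hx
    have := Real.rpow_pos_of_pos hx.1 a
    simp only [Pi.mul_apply]
    rw [Real.rpow_neg hx.1.le]
    field_simp
  have hfm : AEStronglyMeasurable (Function.uncurry f) (μ.prod μ) := by
    have h1 : Measurable fun p : ℝ × ℝ => {p : ℝ × ℝ | p.1 < p.2}.indicator
        (fun p => p.1 ^ (a - 1)) p :=
      Measurable.indicator (by fun_prop) (measurableSet_lt measurable_fst measurable_snd)
    exact h1.aestronglyMeasurable.mul hwm.comp_snd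
  have hinter {x : ℝ} (hx : x ∈ Ioo (0 : ℝ) 1) : Iio x ∩ Ioo 0 1 = Ioo 0 x := by
    ext y
    simp only [mem_inter_iff, mem_Iio, mem_Ioo]
    exact ⟨fun h => ⟨h.2.1, h.1⟩, fun h => ⟨h.2, h.1, h.2.trans hx.2⟩⟩
  have hslice {x : ℝ} (hx : x ∈ Ioo (0 : ℝ) 1) :
      Integrable ((Iio x).indicator fun y => y ^ (a - 1)) μ ∧
      ∫ y, (Iio x).indicator (fun y => y ^ (a - 1)) y ∂μ = x ^ a / a := by
    rw [integrable_indicator_iff measurableSet_Iio, integral_indicator measurableSet_Iio,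
      IntegrableOn, hμ, Measure.restrict_restrict measurableSet_Iio, hinter hx]
    exact integral_Ioo_rpow_sub_one ha hx.1
  have hint : Integrable (Function.uncurry f) (μ.prod μ) := by
    rw [integrable_prod_iff' hfm]
    constructor
    · filter_upwards [ae_restrict_mem measurableSet_Ioo] with x hx
      exact (hslice hx).1.mul_const (w x)
    · refine (hw.norm.div_const a).congr ?_
      filter_upwards [ae_restrict_mem measurableSet_Ioo] with x hx
      have hn : ∀ᵐ y ∂μ, ‖Function.uncurry f (y, x)‖ =
          (Iio x).indicator (fun y => y ^ (a - 1)) y * ‖w x‖ := by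
        filter_upwards [ae_restrict_mem measurableSet_Ioo] with y hy
        simp only [Function.uncurry, f, norm_mul]
        rw [Real.norm_of_nonneg (show 0 ≤ (Iio x).indicator (fun y => y ^ (a - 1)) y from
          indicator_apply_nonneg fun _ => Real.rpow_nonneg hy.1.le _)]
      rw [integral_congr_ae hn, integral_mul_const, (hslice hx).2, norm_mul,
        Real.norm_of_nonneg (Real.rpow_nonneg hx.1.le _)]
      ring
  have hinner {y : ℝ} (hy : y ∈ Ioo (0 : ℝ) 1) :
      ∫ x, f y x ∂μ = y ^ (a - 1) * ∫ x in Ioo y 1, w x := by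
    have h1 : f y = (Ioi y).indicator fun x => y ^ (a - 1) * w x := by
      ext x
      by_cases h : y < x <;> simp [f, h]
    rw [h1, integral_indicator measurableSet_Ioi, hμ,
      Measure.restrict_restrict measurableSet_Ioi, integral_const_mul]
    congr 3
    ext x
    simp only [mem_inter_iff, mem_Ioi, mem_Ioo]
    exact ⟨fun h => ⟨h.1, h.2.2⟩, fun h => ⟨h.1, hy.1.trans h.1, h.2⟩⟩
  have houter : (fun y => ∫ x, f y x ∂μ) =ᵐ[μ]
      fun y => y ^ (a - 1) * ∫ x in Ioo y 1, w x := by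
    filter_upwards [ae_restrict_mem measurableSet_Ioo] with y hy using hinner hy
  refine ⟨hint.integral_prod_left.congr houter, ?_⟩
  rw [← integral_congr_ae houter, integral_integral_swap hint, ← integral_const_mul]
  refine setIntegral_congr_fun measurableSet_Ioo fun x hx => ?_
  simp only [f]
  rw [integral_mul_const, (hslice hx).2]
  field_simp

/-- Unbiasedness of the UMVUE of `1/α` (paper's Theorem 2.6): for `n ≥ 2` and `α > 0`,
`α ∫₀¹ y^{α−1} (∫_y¹ x^{−1}(1−x)^{(n−3)/2} G(x) dx) dy = ∫₀¹ x^{α−1}(1−x)^{(n−3)/2} G(x) dx`,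
all integrals being finite. -/
theorem umvue_reciprocal_shape_unbiased (n : ℕ) (hn : 2 ≤ n) (a : ℝ) (ha : 0 < a) :
    IntegrableOn (fun x : ℝ => x ^ (a - 1) * (1 - x) ^ (((n : ℝ) - 3) / 2) * Gfun n x)
      (Ioo 0 1) ∧
    (∀ y ∈ Ioo (0:ℝ) 1,
      IntegrableOn (fun x : ℝ => x⁻¹ * (1 - x) ^ (((n : ℝ) - 3) / 2) * Gfun n x)
        (Ioo y 1)) ∧
    IntegrableOn (fun y : ℝ => y ^ (a - 1) *
        ∫ x in Ioo y 1, x⁻¹ * (1 - x) ^ (((n : ℝ) - 3) / 2) * Gfun n x) (Ioo 0 1) ∧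
    a * ∫ y in Ioo (0:ℝ) 1, y ^ (a - 1) *
          ∫ x in Ioo y 1, x⁻¹ * (1 - x) ^ (((n : ℝ) - 3) / 2) * Gfun n x
      = ∫ x in Ioo (0:ℝ) 1, x ^ (a - 1) * (1 - x) ^ (((n : ℝ) - 3) / 2) * Gfun n x := by
  have h1 := integrableOn_rpow_mul_Gfun hn ha
  have hpow {x : ℝ} (hx : 0 < x) : x ^ (a - 1) * (1 - x) ^ (((n : ℝ) - 3) / 2) * Gfun n x =
      x ^ a * (x⁻¹ * (1 - x) ^ (((n : ℝ) - 3) / 2) * Gfun n x) := by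
    rw [Real.rpow_sub_one hx.ne']
    ring
  have h2 : IntegrableOn (fun x : ℝ => x ^ a *
      (x⁻¹ * (1 - x) ^ (((n : ℝ) - 3) / 2) * Gfun n x)) (Ioo 0 1) :=
    h1.congr_fun (fun x hx => hpow hx.1) measurableSet_Ioo
  obtain ⟨h3, h4⟩ := integral_rpow_mul_integral_Ioo ha h2
  refine ⟨h1, fun y hy => ?_, h3, ?_⟩
  · have hsub : Ioo y 1 ⊆ Ioo 0 1 := Ioo_subset_Ioo_left hy.1.le
    have hb : IntegrableOn (fun x : ℝ => x ^ (-a) * (x ^ a *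
        (x⁻¹ * (1 - x) ^ (((n : ℝ) - 3) / 2) * Gfun n x))) (Ioo y 1) := by
      refine (h2.mono_set hsub).bdd_mul (c := y ^ (-a))
        (Measurable.aestronglyMeasurable (by fun_prop)) ?_
      filter_upwards [ae_restrict_mem measurableSet_Ioo] with x hx
      rw [Real.norm_of_nonneg (Real.rpow_nonneg (hy.1.trans hx.1).le _)]
      exact Real.rpow_le_rpow_of_nonpos hy.1 hx.1.le (by linarith)
    refine hb.congr_fun (fun x hx => ?_) measurableSet_Ioo
    have hx0 : 0 < x := hy.1.trans hx.1
    simp only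
    rw [← mul_assoc, ← Real.rpow_add hx0, neg_add_cancel, Real.rpow_zero, one_mul]
  · rw [h4]
    exact setIntegral_congr_fun measurableSet_Ioo fun x hx => (hpow hx.1).symm
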